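/- With the notation below, for every θ ∈ (0,1) and ε ∈ (0,1) there exist constants C₇(θ, ε) > 0 and δ₀(θ, ε) > 0 with the following property: if I ⊂ ℝ is a closed interval with nonempty interior, ψ: I → ℝ is 1-convex, m := e^{−ψ} dx is a probability measure on I, δ ∈ (0, δ₀(θ, ε)], a_θ lies in the interior of I, m(I ∩ (−∞, a_θ]) = θ, and e^{−ψ(a_θ)} ≤ e^{−ψ_g(a_θ)} + δ, then for every affine function u(x) = a x + b with a, b ∈ ℝ: ∫_I u² dm − (∫_I u dm)² ≥ (1 − C₇(θ, ε) · δ^{(1−ε)/2}) · a². -/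

import Mathlib

open MeasureTheory Real Set

noncomputable def gw (x : ℝ) : ℝ := (√(2 * π))⁻¹ * rexp (-x ^ 2 / 2)

lemma gw_eq : gw = ProbabilityTheory.gaussianPDFReal 0 1 := by
  ext x; simp [gw, ProbabilityTheory.gaussianPDFReal]

lemma gw_pos (x : ℝ) : 0 < gw x := by unfold gw; positivity

lemma gw_int : Integrable gw := by
  rw [gw_eq]; exact ProbabilityTheory.integrable_gaussianPDFReal 0 1

lemma gw_one : ∫ x, gw x = 1 := by
  rw [gw_eq]; exact ProbabilityTheory.integral_gaussianPDFReal_eq_one 0 one_ne_zero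

lemma gw_mean : ∫ x, x * gw x = 0 := by
  have h := ProbabilityTheory.integral_id_gaussianReal (μ := 0) (v := 1)
  rw [ProbabilityTheory.integral_gaussianReal_eq_integral_smul one_ne_zero, ← gw_eq] at h
  rw [← h]; congr 1; ext x; simp [mul_comm]

lemma gw_sq : ∫ x, x ^ 2 * gw x = 1 := by
  have h := ProbabilityTheory.variance_id_gaussianReal (μ := 0) (v := 1)
  rw [ProbabilityTheory.variance_eq_integral (by fun_prop)] at h
  simp only [id, ProbabilityTheory.integral_id_gaussianReal] at h
  rw [ProbabilityTheory.integral_gaussianReal_eq_integral_smul one_ne_zero, ← gw_eq] at h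
  simp at h
  rw [← h]; congr 1; ext x; simp [mul_comm]

noncomputable def ge (x : ℝ) : ℝ := rexp (-(1/4) * x ^ 2)

lemma ge_pos (x : ℝ) : 0 < ge x := by unfold ge; positivity

lemma ge_pow_int (n : ℕ) : Integrable (fun x => x ^ n * ge x) := by
  have := integrable_rpow_mul_exp_neg_mul_sq (b := 1/4) (by norm_num) (s := (n:ℝ))
    (by have : (0:ℝ) ≤ n := Nat.cast_nonneg n
        linarith)
  simpa [ge] using this

lemma ge_int : Integrable ge := by simpa using ge_pow_int 0

lemma inv_sqrt_le : (√(2 * π))⁻¹ ≤ 1 := by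
  apply inv_le_one_of_one_le₀
  rw [Real.one_le_sqrt]; nlinarith [Real.pi_gt_three]

lemma gw_le (x : ℝ) : gw x ≤ ge x := by
  unfold gw ge
  have : rexp (-x ^ 2 / 2) ≤ rexp (-(1/4) * x ^ 2) := by
    apply Real.exp_le_exp.2; nlinarith [sq_nonneg x]
  nlinarith [inv_sqrt_le, Real.exp_pos (-x ^ 2 / 2)]

lemma dom_int (f : ℝ → ℝ) (hf : AEStronglyMeasurable f volume) (D : ℝ)
    (h : ∀ x, |f x| ≤ D * ge x) (n : ℕ) : Integrable (fun x => x ^ n * f x) := by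
  refine Integrable.mono' ((ge_pow_int n).norm.const_mul D) (by fun_prop) ?_
  refine Filter.Eventually.of_forall fun x => ?_
  simp only [Real.norm_eq_abs, abs_mul, abs_of_pos (ge_pos x)]
  nlinarith [h x, abs_nonneg (x ^ n)]

lemma var_lemma (B : ℝ) (hB : 0 ≤ B) : ∃ C > (0:ℝ), ∀ t : ℝ, 0 < t → t ≤ 1 →
    ∀ ρ : ℝ → ℝ, Integrable ρ → (∀ x, 0 ≤ ρ x) → (∀ x, ρ x ≤ gw x + t ^ 2 * B * ge x) →
    ∫ x, ρ x = 1 →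
    Integrable (fun x => x * ρ x) ∧ Integrable (fun x => x ^ 2 * ρ x) ∧
    1 - C * t ≤ (∫ x, x ^ 2 * ρ x) - (∫ x, x * ρ x) ^ 2 := by
  obtain ⟨M0, hM0⟩ : ∃ M, M = ∫ x, ge x := ⟨_, rfl⟩
  obtain ⟨M2, hM2⟩ : ∃ M, M = ∫ x, x ^ 2 * ge x := ⟨_, rfl⟩
  obtain ⟨M4, hM4⟩ : ∃ M, M = ∫ x, x ^ 4 * ge x := ⟨_, rfl⟩
  have h0 : 0 ≤ M0 := hM0 ▸ integral_nonneg (fun x => (ge_pos x).le)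
  have h2 : 0 ≤ M2 := hM2 ▸ integral_nonneg (fun x => by have := ge_pos x; positivity)
  have h4 : 0 ≤ M4 := hM4 ▸ integral_nonneg (fun x => by have := ge_pos x; positivity)
  set D := ((1 + B) * M4 + B * M0) / 2 with hD
  set D' := B * (M0 + M2) + B * M0 + D with hD'
  have hD0 : 0 ≤ D := by positivity
  have hD'0 : 0 ≤ D' := by positivity
  refine ⟨D + D' ^ 2 + 1, by positivity, ?_⟩
  intro t ht ht1 ρ hρ hρ0 hρle hρ1
  have htt : t ^ 2 ≤ t := by nlinarith
  have hρb : ∀ x, |ρ x| ≤ (1 + B) * ge x := by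
    intro x
    rw [abs_of_nonneg (hρ0 x)]
    have h1 := gw_le x
    have h3 : t ^ 2 * B * ge x ≤ B * ge x := by
      have : 0 ≤ B * ge x := mul_nonneg hB (ge_pos x).le
      nlinarith
    linarith [hρle x]
  have iρ := dom_int ρ hρ.1 _ hρb
  have ig := dom_int gw gw_int.1 1 (fun x => by
    rw [abs_of_pos (gw_pos x), one_mul]; exact gw_le x)
  set h : ℝ → ℝ := fun x => gw x + t ^ 2 * B * ge x - ρ x with hh
  have hh0 : ∀ x, 0 ≤ h x := fun x => by simp only [hh]; linarith [hρle x]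
  have hhb : ∀ x, h x ≤ (1 + B) * ge x := by
    intro x
    have h1 := gw_le x
    have h3 : t ^ 2 * B * ge x ≤ B * ge x := by
      have : 0 ≤ B * ge x := mul_nonneg hB (ge_pos x).le
      nlinarith
    simp only [hh]; linarith [hρ0 x]
  have hint : Integrable h := (gw_int.add (ge_int.const_mul _)).sub hρ
  have ih := dom_int h hint.1 _ (fun x => by rw [abs_of_nonneg (hh0 x)]; exact hhb x)
  have Ih : ∫ x, h x = t ^ 2 * B * M0 := by
    have j : Integrable (fun x => gw x + t ^ 2 * B * ge x) := gw_int.add (ge_int.const_mul _)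
    simp only [hh]
    rw [integral_sub j hρ,
      integral_add gw_int (ge_int.const_mul _), integral_const_mul, gw_one, hρ1, hM0]; ring
  have Ih4 : ∫ x, x ^ 4 * h x ≤ (1 + B) * M4 := by
    rw [hM4, ← integral_const_mul]
    refine integral_mono (ih 4) ((ge_pow_int 4).const_mul _) (fun x => ?_)
    have : 0 ≤ x ^ 4 := by positivity
    dsimp only; nlinarith [hhb x]
  have Ih2 : ∫ x, x ^ 2 * h x ≤ t * D := by
    have : ∫ x, x ^ 2 * h x ≤ ∫ x, (t / 2 * (x ^ 4 * h x) + 1 / (2 * t) * h x) := by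
      refine integral_mono (ih 2) (((ih 4).const_mul _).add (hint.const_mul _)) (fun x => ?_)
      have e : t / 2 * (x ^ 4 * h x) + 1 / (2 * t) * h x - x ^ 2 * h x
          = (t * x ^ 2 - 1) ^ 2 * h x / (2 * t) := by field_simp; ring
      have : 0 ≤ (t * x ^ 2 - 1) ^ 2 * h x / (2 * t) := by have := hh0 x; positivity
      dsimp only; linarith
    rw [integral_add ((ih 4).const_mul _) (hint.const_mul _), integral_const_mul,
      integral_const_mul, Ih] at this
    have e : 1 / (2 * t) * (t ^ 2 * B * M0) = t * (B * M0) / 2 := by field_simp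
    rw [e] at this
    rw [hD]; nlinarith
  have S : ∫ x, x ^ 2 * ρ x = 1 + t ^ 2 * B * M2 - ∫ x, x ^ 2 * h x := by
    have : (fun x => x ^ 2 * ρ x) = fun x =>
        x ^ 2 * gw x + t ^ 2 * B * (x ^ 2 * ge x) - x ^ 2 * h x := by
      ext x; simp only [hh]; ring
    have j : Integrable (fun x => x ^ 2 * gw x + t ^ 2 * B * (x ^ 2 * ge x)) :=
      (ig 2).add ((ge_pow_int 2).const_mul _)
    rw [this, integral_sub j (ih 2),
      integral_add (ig 2) ((ge_pow_int 2).const_mul _), integral_const_mul, gw_sq, hM2]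
  have iρ1 : Integrable (fun x => x * ρ x) := by simpa using iρ 1
  have ig1 : Integrable (fun x => x * gw x) := by simpa using ig 1
  have M : |∫ x, x * ρ x| ≤ t * D' := by
    have e1 : ∫ x, x * ρ x = ∫ x, (x * ρ x - x * gw x) := by
      rw [integral_sub iρ1 ig1, gw_mean, sub_zero]
    have e2 : ‖∫ x, (x * ρ x - x * gw x)‖ ≤ ∫ x, ((t ^ 2 * B) * ge x
        + (t ^ 2 * B) * (x ^ 2 * ge x) + (h x + x ^ 2 * h x)) := by
      refine norm_integral_le_of_norm_le (((ge_int.const_mul _).add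
        ((ge_pow_int 2).const_mul _)).add (hint.add (ih 2))) ?_
      refine Filter.Eventually.of_forall fun x => ?_
      have e : x * ρ x - x * gw x = x * (t ^ 2 * B * ge x - h x) := by simp only [hh]; ring
      rw [e, Real.norm_eq_abs, abs_mul]
      have a1 : |t ^ 2 * B * ge x - h x| ≤ t ^ 2 * B * ge x + h x := by
        have : 0 ≤ t ^ 2 * B * ge x := by have := ge_pos x; positivity
        rw [abs_le]; constructor <;> linarith [hh0 x]
      have a2 : |x| ≤ 1 + x ^ 2 := by
        rw [abs_le]; constructor <;> nlinarith [sq_nonneg (x - 1), sq_nonneg (x + 1)]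
      calc |x| * |t ^ 2 * B * ge x - h x| ≤ (1 + x ^ 2) * (t ^ 2 * B * ge x + h x) := by gcongr
        _ = _ := by ring
    have j1 : Integrable (fun x => t ^ 2 * B * ge x + t ^ 2 * B * (x ^ 2 * ge x)) :=
      (ge_int.const_mul _).add ((ge_pow_int 2).const_mul _)
    have j2 : Integrable (fun x => h x + x ^ 2 * h x) := hint.add (ih 2)
    rw [integral_add j1 j2, integral_add (ge_int.const_mul _)
        ((ge_pow_int 2).const_mul _), integral_add hint (ih 2), integral_const_mul,
        integral_const_mul, ← hM0, ← hM2, Ih, ← e1, Real.norm_eq_abs] at e2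
    have : t ^ 2 * (B * (M0 + M2) + B * M0) ≤ t * (B * (M0 + M2) + B * M0) := by gcongr
    rw [hD']; nlinarith
  refine ⟨iρ1, iρ 2, ?_⟩
  have M' : (∫ x, x * ρ x) ^ 2 ≤ (t * D') ^ 2 := by
    rw [← sq_abs]; gcongr
  have : (t * D') ^ 2 ≤ t * D' ^ 2 := by rw [mul_pow]; gcongr
  have : 0 ≤ t ^ 2 * B * M2 := by positivity
  nlinarith

lemma slope_lemma (S T : Set ℝ) (hS : MeasurableSet S) (hT : MeasurableSet T) (hTS : T ⊆ S)
    (ρ s : ℝ → ℝ) (hρ : Integrable ρ) (k A c δ P q : ℝ) (hk : 0 ≤ k) (hA : 0 < A)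
    (hAc : A ≤ 1 + c * δ) (hP : 0 < P) (hq : 0 < q)
    (hs0 : ∀ x ∈ S, 0 ≤ s x) (hs1 : ∀ x ∈ T, 1 ≤ s x)
    (hb : ∀ x ∈ S, ρ x ≤ A * gw x * rexp (-k * s x))
    (hρP : ∫ x in S, ρ x = P) (hgP : ∫ x in S, gw x = P) (hgq : ∫ x in T, gw x = q)
    (hδ : 2 * P * c / q * δ ≤ 1) : k ≤ 2 * P * c / q * δ := by
  have hle : ∫ x in S, ρ x ≤ ∫ x in S, (A * gw x - A * (1 - rexp (-k)) * T.indicator gw x) := by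
    refine setIntegral_mono_on hρ.integrableOn ((gw_int.const_mul _).sub
      ((gw_int.indicator hT).const_mul _)).integrableOn hS (fun x hx => ?_)
    have hw := gw_pos x
    refine (hb x hx).trans ?_
    by_cases hxT : x ∈ T
    · rw [indicator_of_mem hxT]
      have : rexp (-k * s x) ≤ rexp (-k) := by
        apply Real.exp_le_exp.2; nlinarith [hs1 x hxT]
      have : A * gw x * rexp (-k * s x) ≤ A * gw x * rexp (-k) := by gcongr
      linarith
    · rw [indicator_of_notMem hxT]
      have : rexp (-k * s x) ≤ 1 := by
        apply Real.exp_le_one_iff.2; nlinarith [hs0 x hx]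
      have : A * gw x * rexp (-k * s x) ≤ A * gw x * 1 := by gcongr
      linarith
  rw [integral_sub (gw_int.const_mul _).integrableOn
      ((gw_int.indicator hT).const_mul _).integrableOn, integral_const_mul, integral_const_mul,
      setIntegral_indicator hT, inter_eq_self_of_subset_right hTS, hρP, hgP, hgq] at hle
  set y := 1 - rexp (-k) with hy
  have hy0 : 0 ≤ y := by
    have : rexp (-k) ≤ 1 := Real.exp_le_one_iff.2 (by linarith)
    linarith
  have hA1 : 1 ≤ A := by
    by_contra hc
    push Not at hc
    have : 0 ≤ A * y * q := by positivity
    nlinarith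
  have h1 : y * q ≤ c * δ * P := by
    have : y * q ≤ A * y * q := by
      have : 0 ≤ y * q := by positivity
      nlinarith
    nlinarith
  have h2 : 2 * y ≤ 2 * P * c / q * δ := by
    rw [div_mul_eq_mul_div, le_div_iff₀ hq]; linarith
  have h3 : k ≤ 2 * y := by
    have e1 : 1 + k ≤ rexp k := by linarith [Real.add_one_le_exp k]
    have e2 : rexp k * (1 - y) = 1 := by
      rw [hy, sub_sub_cancel, ← Real.exp_add]; simp
    have : y ≤ 1/2 := by linarith
    nlinarith
  linarith

lemma support_line (I : Set ℝ) (f : ℝ → ℝ) (hf : ConvexOn ℝ I f) (a : ℝ) (ha : a ∈ interior I) :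
    ∃ k : ℝ, ∀ x ∈ I, f a + k * (x - a) ≤ f x := by
  refine ⟨derivWithin f (Ioi a) a, fun x hx => ?_⟩
  rcases lt_trichotomy x a with h | h | h
  · have h1 := hf.slope_le_leftDeriv_of_mem_interior hx ha h
    have h2 := hf.leftDeriv_le_rightDeriv_of_mem_interior ha
    have h3 := h1.trans h2
    rw [slope_def_field, div_le_iff₀ (by linarith)] at h3
    linarith
  · subst h; simp
  · have h1 := hf.rightDeriv_le_slope_of_mem_interior ha hx h
    rw [slope_def_field, le_div_iff₀ (by linarith)] at h1
    linarith

lemma gw_set_pos (S : Set ℝ) (hS : MeasurableSet S) (h : 0 < volume S) : 0 < ∫ x in S, gw x := by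
  rw [setIntegral_pos_iff_support_of_nonneg_ae
    (Filter.Eventually.of_forall fun x => (gw_pos x).le) gw_int.integrableOn]
  have : Function.support gw = univ := by
    ext x; simp [(gw_pos x).ne']
  rw [this, univ_inter]; exact h

lemma upper_lemma (a c K δ A k x : ℝ) (hc : 0 ≤ c) (hK : 0 ≤ K) (hδ : 0 < δ) (hδ1 : δ ≤ 1)
    (hA : A ≤ 1 + c * δ) (hA0 : 0 < A) (hk : |k| ≤ K * δ) (hKδ : K * δ ≤ 1) :
    A * gw x * rexp (-k * (x - a)) ≤
      gw x + δ * ((c + K + c * K) * rexp (2 * |a| + 4)) * ge x := by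
  set s := |x - a| with hs
  have hs0 : 0 ≤ s := abs_nonneg _
  have e1 : rexp (-k * (x - a)) ≤ rexp (K * δ * s) := by
    apply Real.exp_le_exp.2
    calc -k * (x - a) ≤ |-k * (x - a)| := le_abs_self _
      _ = |k| * s := by rw [abs_mul, abs_neg]
      _ ≤ _ := by gcongr
  have e2 : rexp (K * δ * s) ≤ 1 + K * δ * rexp (2 * s) := by
    have h1 : 1 - K * δ * s ≤ rexp (-(K * δ * s)) := by
      linarith [Real.add_one_le_exp (-(K * δ * s))]
    have h2 : rexp (K * δ * s) * rexp (-(K * δ * s)) = 1 := by rw [← Real.exp_add]; simp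
    have h3 : rexp (K * δ * s) ≤ 1 + K * δ * s * rexp (K * δ * s) := by
      nlinarith [Real.exp_pos (K * δ * s)]
    have h4 : rexp (K * δ * s) ≤ rexp s := by apply Real.exp_le_exp.2; nlinarith
    have h5 : s ≤ rexp s := by linarith [Real.add_one_le_exp s]
    have h6 : s * rexp (K * δ * s) ≤ rexp (2 * s) := by
      rw [two_mul, Real.exp_add]; gcongr
    have : K * δ * (s * rexp (K * δ * s)) ≤ K * δ * rexp (2 * s) := by gcongr
    linarith
  have e3 : 1 ≤ rexp (2 * s) := Real.one_le_exp (by positivity)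
  have e4 : A * rexp (-k * (x - a)) ≤ 1 + δ * (c + K + c * K) * rexp (2 * s) := by
    calc A * rexp (-k * (x - a)) ≤ (1 + c * δ) * (1 + K * δ * rexp (2 * s)) := by
          gcongr; exact e1.trans e2
      _ = 1 + c * δ + K * δ * rexp (2 * s) + c * K * δ * δ * rexp (2 * s) := by ring
      _ ≤ 1 + c * δ * rexp (2 * s) + K * δ * rexp (2 * s) + c * K * δ * 1 * rexp (2 * s) := by
          have z1 : c * δ ≤ c * δ * rexp (2 * s) := le_mul_of_one_le_right (by positivity) e3
          have z2 : c * K * δ * δ * rexp (2 * s) ≤ c * K * δ * 1 * rexp (2 * s) := by gcongr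
          linarith
      _ = _ := by ring
  have e5 : rexp (2 * s) * gw x ≤ rexp (2 * |a| + 4) * ge x := by
    have h1 : rexp (2 * s) * rexp (-x ^ 2 / 2) ≤ rexp (2 * |a| + 4) * ge x := by
      unfold ge
      rw [← Real.exp_add, ← Real.exp_add]
      apply Real.exp_le_exp.2
      have : s ≤ |x| + |a| := abs_sub x a
      have := sq_abs x
      nlinarith [sq_nonneg (|x| - 4)]
    have h2 : gw x ≤ rexp (-x ^ 2 / 2) := by
      unfold gw
      exact mul_le_of_le_one_left (Real.exp_pos _).le inv_sqrt_le
    refine le_trans ?_ h1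
    gcongr
  have hg := gw_pos x
  calc A * gw x * rexp (-k * (x - a)) = (A * rexp (-k * (x - a))) * gw x := by ring
    _ ≤ (1 + δ * (c + K + c * K) * rexp (2 * s)) * gw x := by gcongr
    _ = gw x + δ * (c + K + c * K) * (rexp (2 * s) * gw x) := by ring
    _ ≤ gw x + δ * (c + K + c * K) * (rexp (2 * |a| + 4) * ge x) := by gcongr
    _ = _ := by ring

theorem stmt12 :
    ∀ θ ∈ Ioo (0:ℝ) 1, ∀ ε ∈ Ioo (0:ℝ) 1, ∀ aθ : ℝ,
      (1 / Real.sqrt (2 * π)) * (∫ t in Iic aθ, Real.exp (-t ^ 2 / 2)) = θ →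
      ∃ C₇ > (0:ℝ), ∃ δ₀ > (0:ℝ),
        ∀ (I : Set ℝ), IsClosed I → Convex ℝ I → (interior I).Nonempty →
        ∀ ψ : ℝ → ℝ, ConvexOn ℝ I (fun x => ψ x - x ^ 2 / 2) →
        (∫ x in I, Real.exp (-ψ x)) = 1 →
        ∀ δ : ℝ, 0 < δ → δ ≤ δ₀ →
        aθ ∈ interior I →
        (∫ x in I ∩ Iic aθ, Real.exp (-ψ x)) = θ →
        Real.exp (-ψ aθ) ≤ Real.exp (-(Real.log (Real.sqrt (2 * π)) + aθ ^ 2 / 2)) + δ →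
        ∀ a b : ℝ,
          (∫ x in I, (a * x + b) ^ 2 * Real.exp (-ψ x)) -
              (∫ x in I, (a * x + b) * Real.exp (-ψ x)) ^ 2
            ≥ (1 - C₇ * δ ^ ((1 - ε) / 2)) * a ^ 2 := by
  intro θ hθ ε hε p hp
  have hgθ : ∫ x in Iic p, gw x = θ := by
    rw [← hp]; simp only [gw]; rw [integral_const_mul, one_div]
  have hgθ' : ∫ x in Ioi p, gw x = 1 - θ := by
    have := intervalIntegral.integral_Iic_add_Ioi (b := p) gw_int.integrableOn gw_int.integrableOn
    rw [gw_one, hgθ] at this; linarith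
  obtain ⟨q₁, hq₁⟩ : ∃ q, ∫ x in Ioi (p + 1), gw x = q := ⟨_, rfl⟩
  obtain ⟨q₂, hq₂⟩ : ∃ q, ∫ x in Iic (p - 1), gw x = q := ⟨_, rfl⟩
  have hq₁0 : 0 < q₁ := hq₁ ▸ gw_set_pos _ measurableSet_Ioi (by simp)
  have hq₂0 : 0 < q₂ := hq₂ ▸ gw_set_pos _ measurableSet_Iic (by simp)
  set c := 1 / gw p with hc
  have hgp := gw_pos p
  have hc0 : 0 < c := by positivity
  obtain ⟨hθ0, hθ1⟩ := hθ
  have hP : 0 < 1 - θ := by linarith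
  set K₁ := 2 * (1 - θ) * c / q₁ with hK₁
  set K₂ := 2 * θ * c / q₂ with hK₂
  have hK₁0 : 0 < K₁ := by positivity
  have hK₂0 : 0 < K₂ := by positivity
  set K := K₁ + K₂ with hK
  have hK0 : 0 < K := by positivity
  obtain ⟨C, hC, hvar⟩ := var_lemma ((c + K + c * K) * rexp (2 * |p| + 4)) (by positivity)
  refine ⟨C, hC, 1 / (K + 1), by positivity, ?_⟩
  intro I hIc hIconv hIne ψ hψ hm δ hδ hδ0 hpI hmθ hub a b
  have hδK : δ * (K + 1) ≤ 1 := by rwa [le_div_iff₀ (by positivity)] at hδ0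
  have hKδ : K * δ ≤ 1 := by nlinarith
  have hδ1 : δ ≤ 1 := by nlinarith
  have hIm := hIc.measurableSet
  set ρ : ℝ → ℝ := I.indicator (fun x => rexp (-ψ x)) with hρ
  have hint : ∀ f : ℝ → ℝ, ∫ x in I, f x * rexp (-ψ x) = ∫ x, f x * ρ x := by
    intro f
    rw [← integral_indicator hIm]
    congr 1; ext x
    by_cases hx : x ∈ I <;> simp [hρ, hx]
  have hρ1 : ∫ x, ρ x = 1 := by rw [hρ, integral_indicator hIm, hm]
  have hρi : Integrable ρ := by
    by_contra hn
    rw [integral_undef hn] at hρ1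
    norm_num at hρ1
  have hρ0 : ∀ x, 0 ≤ ρ x := fun x => indicator_nonneg (fun _ _ => (Real.exp_pos _).le) x
  have hρθ : ∫ x in Iic p, ρ x = θ := by
    rw [hρ, setIntegral_indicator hIm, inter_comm, hmθ]
  have hρθ' : ∫ x in Ioi p, ρ x = 1 - θ := by
    have := intervalIntegral.integral_Iic_add_Ioi (b := p) hρi.integrableOn hρi.integrableOn
    rw [hρ1, hρθ] at this; linarith
  obtain ⟨k, hk⟩ := support_line I _ hψ p hpI
  set A := rexp (-ψ p) / gw p with hA
  have hA0 : 0 < A := by positivity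
  have hgp' : rexp (-(Real.log (Real.sqrt (2 * π)) + p ^ 2 / 2)) = gw p := by
    unfold gw
    rw [neg_add, Real.exp_add, Real.exp_neg, Real.exp_log (by positivity)]
    congr 2; ring
  have hAc : A ≤ 1 + c * δ := by
    rw [hA, div_le_iff₀ hgp, hc]
    rw [hgp'] at hub
    have : (1 + 1 / gw p * δ) * gw p = gw p + δ := by field_simp
    linarith
  have hb : ∀ x, ρ x ≤ A * gw x * rexp (-k * (x - p)) := by
    intro x
    by_cases hx : x ∈ I
    · have h1 := hk x hx
      simp only [hρ, indicator_of_mem hx]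
      have e : A * gw x * rexp (-k * (x - p)) =
          rexp (-ψ p + p ^ 2 / 2 + -x ^ 2 / 2 + -k * (x - p)) := by
        rw [Real.exp_add, Real.exp_add, Real.exp_add, hA]
        have : rexp (p ^ 2 / 2) = (rexp (-p ^ 2 / 2))⁻¹ := by rw [← Real.exp_neg]; congr 1; ring
        rw [this]
        unfold gw
        field_simp
      rw [e]
      apply Real.exp_le_exp.2
      linarith
    · simp only [hρ, indicator_of_notMem hx]
      have := gw_pos x
      positivity
  have hkK : |k| ≤ K * δ := by
    have t1 : 0 < K₁ * δ := by positivity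
    have t2 : 0 < K₂ * δ := by positivity
    have t3 : K * δ = K₁ * δ + K₂ * δ := by rw [hK]; ring
    rcases le_total 0 k with h | h
    · have := slope_lemma (Ioi p) (Ioi (p + 1)) measurableSet_Ioi measurableSet_Ioi
        (Ioi_subset_Ioi (by linarith)) ρ (fun x => x - p) hρi k A c δ (1 - θ) q₁ h hA0 hAc hP hq₁0
        (fun x hx => by rw [mem_Ioi] at hx; linarith) (fun x hx => by rw [mem_Ioi] at hx; linarith)
        (fun x _ => hb x) hρθ' hgθ' hq₁ (by rw [← hK₁]; linarith)
      rw [abs_of_nonneg h]; linarith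
    · have := slope_lemma (Iic p) (Iic (p - 1)) measurableSet_Iic measurableSet_Iic
        (Iic_subset_Iic.2 (by linarith)) ρ (fun x => p - x) hρi (-k) A c δ θ q₂ (by linarith)
        hA0 hAc hθ0 hq₂0
        (fun x hx => by rw [mem_Iic] at hx; linarith) (fun x hx => by rw [mem_Iic] at hx; linarith)
        (fun x _ => by
          have e : - -k * (p - x) = -k * (x - p) := by ring
          rw [e]; exact hb x) hρθ hgθ hq₂ (by rw [← hK₂]; linarith)
      rw [abs_of_nonpos h]; linarith
  have hsq : √δ ^ 2 = δ := Real.sq_sqrt hδ.le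
  obtain ⟨i1, i2, hv⟩ := hvar (√δ) (Real.sqrt_pos.2 hδ) (Real.sqrt_le_one.2 hδ1) ρ hρi hρ0
    (fun x => by
      rw [hsq]
      exact (hb x).trans (upper_lemma p c K δ A k x hc0.le hK0.le hδ hδ1 hAc hA0 hkK hKδ)) hρ1
  have hrp : √δ ≤ δ ^ ((1 - ε) / 2) := by
    rw [Real.sqrt_eq_rpow]
    exact Real.rpow_le_rpow_of_exponent_ge hδ hδ1 (by linarith [hε.1])
  rw [hint (fun x => (a * x + b) ^ 2), hint (fun x => a * x + b)]
  have I1 : ∫ x, (a * x + b) * ρ x = a * (∫ x, x * ρ x) + b := by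
    have e : (fun x => (a * x + b) * ρ x) = fun x => a * (x * ρ x) + b * ρ x := by ext x; ring
    rw [e, integral_add (i1.const_mul _) (hρi.const_mul _), integral_const_mul,
      integral_const_mul, hρ1, mul_one]
  have I2 : ∫ x, (a * x + b) ^ 2 * ρ x =
      a ^ 2 * (∫ x, x ^ 2 * ρ x) + 2 * a * b * (∫ x, x * ρ x) + b ^ 2 := by
    have e : (fun x => (a * x + b) ^ 2 * ρ x) =
      fun x => (a ^ 2 * (x ^ 2 * ρ x) + 2 * a * b * (x * ρ x)) + b ^ 2 * ρ x := by ext x; ring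
    have j : Integrable (fun x => a ^ 2 * (x ^ 2 * ρ x) + 2 * a * b * (x * ρ x)) :=
      (i2.const_mul _).add (i1.const_mul _)
    rw [e, integral_add j (hρi.const_mul _), integral_add (i2.const_mul _) (i1.const_mul _),
      integral_const_mul, integral_const_mul, integral_const_mul, hρ1, mul_one]
  rw [I1, I2]
  have hfin : 1 - C * δ ^ ((1 - ε) / 2) ≤ (∫ x, x ^ 2 * ρ x) - (∫ x, x * ρ x) ^ 2 := by
    have : C * √δ ≤ C * δ ^ ((1 - ε) / 2) := by gcongr
    linarith
  have := mul_le_mul_of_nonneg_right hfin (sq_nonneg a)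
  nlinarith
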